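/- For every looped digraph G (with one loop at each vertex and an arbitrary set of red non-loop arcs), the two partition functions agree: J′(G) = J(G) as polynomials in λ and the variables x_e. -/

import Mathlib

open Finset

/-! ### Permanents -/

/-- The permanent of a square matrix. -/
noncomputable def perm {ι R : Type*} [Fintype ι] [DecidableEq ι] [CommRing R]
    (M : Matrix ι ι R) : R :=
  ∑ σ : Equiv.Perm ι, ∏ i, M i (σ i)

/-! ### Chord diagrams -/

/-- A chord diagram with `n` chords: a partition of `{1,…,2n}` into `n` two-element
subsets (chords), each recorded by its left endpoint `l i` and right endpoint `r i`,
with the chords numbered in increasing order of their left endpoints. -/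
structure ChordDiagram (n : ℕ) where
  l : Fin n → Fin (2 * n)
  r : Fin n → Fin (2 * n)
  lr : ∀ i, l i < r i
  mono : StrictMono l
  cover : ∀ q : Fin (2 * n), ∃! i : Fin n, l i = q ∨ r i = q

namespace ChordDiagram

variable {n : ℕ}

/-- Chords `i` and `j` intersect. -/
abbrev Intersect (D : ChordDiagram n) (i j : Fin n) : Prop :=
  (D.l i < D.l j ∧ D.l j < D.r i ∧ D.r i < D.r j) ∨
  (D.l j < D.l i ∧ D.l i < D.r j ∧ D.r j < D.r i)

/-- Chord `i` is completely contained in chord `j`. -/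
abbrev Contained (D : ChordDiagram n) (i j : Fin n) : Prop :=
  D.l j < D.l i ∧ D.r i < D.r j

/-- The five colors `I, B⁺₀, B⁺₁, B⁻₀, B⁻₁` (`true` encodes subscript `1`). -/
inductive JCol where
  | I : JCol
  | Bp : Bool → JCol
  | Bm : Bool → JCol
  deriving DecidableEq, Fintype

/-- The contribution `δ` of a left endpoint of a chord with a given color. -/
def lsign : JCol → ℤ
  | .Bp true => 1
  | .Bm true => -1
  | _ => 0

/-- `δ(q)` for a coloring `ρ` of the chords of `D`. -/
def delta (D : ChordDiagram n) (ρ : Fin n → JCol) (q : Fin (2 * n)) : ℤ :=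
  ∑ v : Fin n, ((if D.l v = q then lsign (ρ v) else 0) +
                (if D.r v = q then - lsign (ρ v) else 0))

/-- `Σ_{q < p} δ(q)`. -/
def kOf (D : ChordDiagram n) (ρ : Fin n → JCol) (p : Fin (2 * n)) : ℤ :=
  ∑ q ∈ univ.filter (fun q => q < p), D.delta ρ q

/-- The weight `ω_ρ(v)` of chord `v` under the coloring `ρ`. -/
noncomputable def omega (D : ChordDiagram n) (ρ : Fin n → JCol) (v : Fin n) :
    Polynomial ℚ :=
  match ρ v with
  | .I => Polynomial.X + 2
  | .Bp ε => - (-1 : Polynomial ℚ) ^ (if ε then 1 else 0) *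
      (1 + ((D.kOf ρ (D.l v) : ℤ) : Polynomial ℚ)) *
      (Polynomial.X + 1 - ((D.kOf ρ (D.r v) : ℤ) : Polynomial ℚ))
  | .Bm ε => - (-1 : Polynomial ℚ) ^ (if ε then 1 else 0) *
      (1 + ((D.kOf ρ (D.r v) : ℤ) : Polynomial ℚ)) *
      (Polynomial.X + 1 - ((D.kOf ρ (D.l v) : ℤ) : Polynomial ℚ))

/-- The colored Jones weight system `W_J(D) ∈ ℚ[λ]` (with `λ = X`). -/
noncomputable def WJ (D : ChordDiagram n) : Polynomial ℚ :=
  ∑ ρ : Fin n → JCol, ∏ v : Fin n, D.omega ρ v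

/-- The intersection matrix `IM(D)` with entries `sign(i−j)` for intersecting chords. -/
def IM (D : ChordDiagram n) : Matrix (Fin n) (Fin n) ℚ := fun i j =>
  if D.Intersect i j then (if j < i then 1 else if i < j then -1 else 0) else 0

/-- The `3×3` block `A₀`. -/
noncomputable def A0 : Matrix (Fin 3) (Fin 3) (Polynomial ℚ) :=
  !![Polynomial.X + 2, 0, 0; 0, Polynomial.X + 2, 1; Polynomial.X, -Polynomial.X - 2, 1]

/-- The `3×3` block `A₊`. -/
noncomputable def Aplus : Matrix (Fin 3) (Fin 3) (Polynomial ℚ) := !![1, 1, 0; 0, 0, 0; 0, 0, 0]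

/-- The `3×3` block `A₋`. -/
noncomputable def Aminus : Matrix (Fin 3) (Fin 3) (Polynomial ℚ) := !![0, 0, 0; -1, -1, 0; 0, 0, 0]

/-- The `3×3` block `A_c`. -/
noncomputable def Acont : Matrix (Fin 3) (Fin 3) (Polynomial ℚ) := !![1, 1, 0; -1, -1, 0; 0, 0, 0]

/-- The blown-up intersection matrix `IM_J(D)`, a `3n×3n` matrix of `3×3` blocks. -/
noncomputable def IMJ (D : ChordDiagram n) :
    Matrix (Fin n × Fin 3) (Fin n × Fin 3) (Polynomial ℚ) := fun p q =>
  (if p.1 = q.1 then A0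
   else if q.1 < p.1 ∧ D.Intersect p.1 q.1 then Aplus
   else if p.1 < q.1 ∧ D.Intersect p.1 q.1 then Aminus
   else if ¬ D.Intersect p.1 q.1 ∧ D.Contained p.1 q.1 then Acont
   else 0) p.2 q.2

end ChordDiagram

/-! ### Looped digraphs -/

/-- A looped digraph: a finite digraph (arcs a set of ordered pairs) with a loop at
every vertex and a distinguished set of red non-loop arcs. -/
structure LoopedDigraph (V : Type*) [Fintype V] [DecidableEq V] where
  arcs : Finset (V × V)
  red : Finset (V × V)
  loop_mem : ∀ v : V, (v, v) ∈ arcs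
  red_sub : red ⊆ arcs
  red_no_loop : ∀ v : V, (v, v) ∉ red

/-- A thickened arc `(e, b)`, where `e` is an arc of the digraph and `b : Bool` records:
for an uncolored arc, whether it is thickened at its tail (`true`) or head (`false`);
for a red arc (always thickened at its tail `e.1`), whether it keeps its original
orientation (`true`) or is reversed (`false`). Loops always carry `b = true`. -/
abbrev TArc (V : Type*) := (V × V) × Bool

variable {V : Type*} [Fintype V] [DecidableEq V]

/-- The degree of `v` in a collection `K` of thickened arcs: the number of arc-ends of
`K` at `v` (a loop contributing `2`). -/
def degAt (K : Finset (TArc V)) (v : V) : ℕ :=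
  ∑ t ∈ K, ((if t.1.1 = v then 1 else 0) + (if t.1.2 = v then 1 else 0))

/-- `deg₄(K)`: the number of vertices of degree `4` in `K`. -/
def deg4 (K : Finset (TArc V)) : ℕ := (univ.filter fun v => degAt K v = 4).card

namespace LoopedDigraph

variable (G : LoopedDigraph V)

/-- The initial vertex of a thickened arc, as oriented in the collection. -/
def src (t : TArc V) : V := if t.1 ∈ G.red ∧ t.2 = false then t.1.2 else t.1.1

/-- The terminal vertex of a thickened arc, as oriented in the collection. -/
def dst (t : TArc V) : V := if t.1 ∈ G.red ∧ t.2 = false then t.1.1 else t.1.2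

/-- The vertex at which a thickened arc is thickened. -/
def tvert (t : TArc V) : V := if t.1 ∈ G.red then t.1.1 else if t.2 then t.1.1 else t.1.2

/-- The number of arcs of `K` thickened at `v`. -/
def thickAt (K : Finset (TArc V)) (v : V) : ℕ := (K.filter fun t => G.tvert t = v).card

/-- The number of arcs of `K` thickened at `v` that leave `v` (a loop counting as
leaving). -/
def outThickAt (K : Finset (TArc V)) (v : V) : ℕ :=
  (K.filter fun t => G.tvert t = v ∧ G.src t = v).card

/-- An acceptable object for a looped digraph. -/
structure IsAcceptable (K : Finset (TArc V)) : Prop where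
  mem_arcs : ∀ t ∈ K, t.1 ∈ G.arcs
  loop_thick : ∀ t ∈ K, t.1.1 = t.1.2 → t.2 = true
  deg024 : ∀ v, degAt K v = 0 ∨ degAt K v = 2 ∨ degAt K v = 4
  half_thick : ∀ v, 2 * G.thickAt K v = degAt K v
  balance : ∀ v, G.thickAt K v = 2 → G.outThickAt K v = 1

/-- `a(K)`: the number of arcs of `K` thickened at their initial vertex (loops count). -/
def aK (K : Finset (TArc V)) : ℕ := (K.filter fun t => G.src t = G.tvert t).card

open Classical in
/-- The partition function `J(G)`, with `λ ↦ lam` and `x_e ↦ x e`. -/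
noncomputable def J {R : Type*} [CommRing R] (lam : R) (x : V × V → R) : R :=
  ∑ K : Finset (TArc V),
    if G.IsAcceptable K then
      2 ^ deg4 K * (lam + 2) ^ (Fintype.card V - deg4 K) *
        (∏ t ∈ K, x t.1) * (-1 : R) ^ G.aK K
    else 0

/-- `s(w) = δ_w · ε_w` for a partial coloring `c` (with support the set `V′`). -/
def sInt (c : V → Option (Bool × Bool)) (w : V) : ℤ :=
  match c w with
  | none => 0
  | some (δ, ε) => (if δ then 1 else -1) * (if ε then 1 else 0)

/-- `z_v(e)` (for `bar = false`) and `z̄_v(e)` (for `bar = true`). -/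
def zfun {R : Type*} [CommRing R] (x : V × V → R) (c : V → Option (Bool × Bool))
    (bar : Bool) (v : V) (e : V × V) : R :=
  match c v with
  | none => 0
  | some (δ, _) =>
    if e ∈ G.red then
      (if e.1 = v then ((sInt c e.2 : ℤ) : R) * x e else 0)
    else if e.1 = v then (if δ = bar then ((sInt c e.2 : ℤ) : R) * x e else 0)
    else if e.2 = v then (if δ ≠ bar then ((sInt c e.1 : ℤ) : R) * x e else 0)
    else 0

/-- The weight `ω′_c(v)`. -/
noncomputable def omegaC {R : Type*} [CommRing R] (lam : R) (x : V × V → R)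
    (c : V → Option (Bool × Bool)) (v : V) : R :=
  match c v with
  | none => 0
  | some (_, ε) =>
    - (-1 : R) ^ (if ε then 1 else 0) *
      (1 + ∑ e ∈ G.arcs, G.zfun x c false v e) *
      (lam + 1 - ∑ e ∈ G.arcs, G.zfun x c true v e)

/-- The state sum `J′(G)`: the sum over `V′ ⊆ V` and colorings `c` of `V′` is encoded
as a sum over partial colorings `c : V → Option (Bool × Bool)` with support `V′`. -/
noncomputable def J' {R : Type*} [CommRing R] (lam : R) (x : V × V → R) : R :=
  ∑ c : V → Option (Bool × Bool),
    (lam + 2) ^ (univ.filter fun v => c v = none).card *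
      ∏ v ∈ univ.filter (fun v => (c v).isSome = true), G.omegaC lam x c v

end LoopedDigraph

/-! ### The labeled intersection digraph of a chord diagram -/

open ChordDiagram in
/-- The labeled intersection digraph `LID(D)` of a chord diagram `D`. -/
def LID {n : ℕ} (D : ChordDiagram n) : LoopedDigraph (Fin n) where
  arcs := univ.filter fun p : Fin n × Fin n =>
    p.1 = p.2 ∨ (p.1 < p.2 ∧ D.Intersect p.1 p.2) ∨ D.Contained p.1 p.2
  red := univ.filter fun p : Fin n × Fin n => D.Contained p.1 p.2
  loop_mem := by intro v; simp
  red_sub := by intro p hp; simp only [mem_filter, mem_univ, true_and] at hp ⊢; tauto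
  red_no_loop := by
    intro v hv
    simp only [mem_filter, mem_univ, true_and] at hv
    exact lt_irrefl _ hv.1

/-! ### The data `(V′, h)` and the state sum `A(V′, h)` -/

/-- The data of a function `h` assigning to every `v ∈ V′` a set of at most two arcs of
`G` incident with `v`, every red arc of `h v` leaving `v` (and `h v = ∅` off `V′`). -/
structure HData (G : LoopedDigraph V) (V' : Finset V) where
  h : V → Finset (V × V)
  sub : ∀ v, h v ⊆ G.arcs
  card_le : ∀ v, (h v).card ≤ 2
  incident : ∀ v, ∀ e ∈ h v, e.1 = v ∨ e.2 = v
  red_out : ∀ v, ∀ e ∈ h v, e ∈ G.red → e.1 = v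
  outside : ∀ v, v ∉ V' → h v = ∅

/-- The number of arc-ends at `v` among a set of thickened arcs `(e, w)`. -/
def endCountAt (S : Finset ((V × V) × V)) (v : V) : ℕ :=
  ∑ p ∈ S, ((if p.1.1 = v then 1 else 0) + (if p.1.2 = v then 1 else 0))

namespace HData

variable {G : LoopedDigraph V} {V' : Finset V} (H : HData G V')

/-- `W₁ = {v ∈ V′ : |h(v)| = 2}`. -/
def W1 : Finset V := V'.filter fun v => (H.h v).card = 2

/-- `W₂ = {v ∈ V′ : |h(v)| ≥ 1}`. -/
def W2 : Finset V := V'.filter fun v => 1 ≤ (H.h v).card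

/-- `h(W₂)`: the set of thickened arcs `(e, v)` with `v ∈ W₂` and `e ∈ h v`. -/
def hW2 : Finset ((V × V) × V) :=
  univ.filter fun p => p.2 ∈ H.W2 ∧ p.1 ∈ H.h p.2

/-- The functions `g` on `S` with `g v ∈ h v`, encoded as singleton-valued selections
`gs : V → Finset (V × V)` (with `gs v = ∅` off `S`). -/
def choices (S : Finset V) : Finset (V → Finset (V × V)) :=
  univ.filter fun gs => ∀ v, gs v ⊆ H.h v ∧
    (v ∈ S → (gs v).card = 1) ∧ (v ∉ S → gs v = ∅)

/-- The summand `B(c, V₂′, g)`; here `g` is encoded by the selection `gs` on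
`W₁ ∪ V₂′` and the complementary function `f` (on `W₁ ∪ V₁′`, `V₁′ = W₂∖(W₁∪V₂′)`)
is encoded by the complementary selection `h v ∖ gs v`. -/
noncomputable def Bterm {R : Type*} [CommRing R] (lam : R) (x : V × V → R)
    (c : V → Option (Bool × Bool)) (V2 : Finset V) (gs : V → Finset (V × V)) : R :=
  (-1 : R) ^ (∑ v ∈ V', ((c v).elim 0 fun p => if p.2 then 1 else 0 : ℕ)) *
  (-1 : R) ^ (H.W1 ∪ V2).card *
  (lam + 1) ^ (V' \ (H.W1 ∪ V2)).card *
  (∏ v ∈ H.W1 ∪ V2, ∏ e ∈ gs v, G.zfun x c true v e) *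
  (∏ v ∈ H.W1 ∪ (H.W2 \ (H.W1 ∪ V2)), ∏ e ∈ H.h v \ gs v, G.zfun x c false v e)

open Classical in
/-- The state sum `A(V′, h)`. -/
noncomputable def Aval {R : Type*} [CommRing R] (lam : R) (x : V × V → R) : R :=
  ∑ c : V → Option (Bool × Bool),
    if (∀ v, (c v).isSome = true ↔ v ∈ V') then
      ∑ V2 ∈ (H.W2 \ H.W1).powerset, ∑ gs ∈ H.choices (H.W1 ∪ V2),
        H.Bterm lam x c V2 gs
    else 0

end HData

/-! ### Good collections and the state sum `C(X, V′, K)` -/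

namespace LoopedDigraph

/-- A collection of thickened arcs good on `V′`. -/
structure IsGood (G : LoopedDigraph V) (V' : Finset V) (K : Finset (TArc V)) : Prop where
  mem_arcs : ∀ t ∈ K, t.1 ∈ G.arcs
  loop_thick : ∀ t ∈ K, t.1.1 = t.1.2 → t.2 = true
  red_orig : ∀ t ∈ K, t.1 ∈ G.red → t.2 = true
  deg_mem : ∀ v ∈ V', degAt K v = 2 ∨ degAt K v = 4
  deg_out : ∀ v, v ∉ V' → degAt K v = 0
  half_thick : ∀ v, 2 * G.thickAt K v = degAt K v
  unc_opp : ∀ t ∈ K, ∀ s ∈ K, t ≠ s → t.1 ∉ G.red → s.1 ∉ G.red →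
    G.tvert t = G.tvert s → ((G.src t = G.tvert t) ↔ ¬ (G.src s = G.tvert s))

/-- The set `W₁` of degree-4 vertices of a collection `K`. -/
def KW1 (G : LoopedDigraph V) (K : Finset (TArc V)) : Finset V :=
  univ.filter fun v => degAt K v = 4

/-- The arcs of `K` thickened at `v`. -/
def thickedAt (G : LoopedDigraph V) (K : Finset (TArc V)) (v : V) : Finset (TArc V) :=
  K.filter fun t => G.tvert t = v

/-- The functions `g′` assigning to each degree-4 vertex one of the two arcs of `K`
thickened at it, encoded as singleton-valued selections. -/
def kchoices (G : LoopedDigraph V) (K : Finset (TArc V)) : Finset (V → Finset (TArc V)) :=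
  univ.filter fun cs => ∀ v, cs v ⊆ G.thickedAt K v ∧
    (v ∈ KW1 G K → (cs v).card = 1) ∧ (v ∉ KW1 G K → cs v = ∅)

open Classical in
/-- The state sum `C(X, V′, K)`. -/
noncomputable def Cval {R : Type*} [CommRing R] (G : LoopedDigraph V) (V' : Finset V)
    (K : Finset (TArc V)) (X : Finset V) (x : V × V → R) : R :=
  ∑ cs ∈ kchoices G K,
    (-1 : R) ^ (KW1 G K).card * (-1 : R) ^ X.card *
    ∑ c : V → Option (Bool × Bool),
      if (∀ v, (c v).isSome = true ↔ v ∈ V') then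
        (∏ v ∈ KW1 G K ∪ X,
          ∏ t ∈ (if v ∈ KW1 G K then cs v else G.thickedAt K v), G.zfun x c true v t.1) *
        (∏ v ∈ V' \ X, ∏ t ∈ G.thickedAt K v \ cs v, G.zfun x c false v t.1)
      else 0

/-- A connected acceptable object: one with no single loops. -/
def IsConnectedObj (G : LoopedDigraph V) (K : Finset (TArc V)) : Prop :=
  G.IsAcceptable K ∧ ∀ t ∈ K, t.1.1 = t.1.2 → degAt K t.1.1 ≠ 2

/-- A super acceptable object: connected, and every vertex has degree at least 2. -/
def IsSuper (G : LoopedDigraph V) (K : Finset (TArc V)) : Prop :=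
  G.IsConnectedObj K ∧ ∀ v, 2 ≤ degAt K v

end LoopedDigraph
namespace JProof

open LoopedDigraph

variable {V : Type*} [Fintype V] [DecidableEq V] (G : LoopedDigraph V)

/-- The end of a thickened arc which is not thickened. -/
def other (t : TArc V) : V := if t.1 ∈ G.red then t.1.2 else if t.2 then t.1.2 else t.1.1

/-- Legal thickened arcs. -/
def Valid (t : TArc V) : Prop := t.1 ∈ G.arcs ∧ (t.1.1 = t.1.2 → t.2 = true)

instance : DecidablePred (Valid G) := fun t => by unfold Valid; infer_instance

/-- Legal arcs thickened at `v`, leaving `v` (`b = true`) or entering `v`. -/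
def side (b : Bool) (v : V) : Finset (TArc V) :=
  univ.filter fun t => Valid G t ∧ G.tvert t = v ∧ (G.src t = v ↔ b = true)

/-- Value of a color. -/
def sval : Option (Bool × Bool) → ℤ
  | none => 0
  | some (δ, ε) => (if δ then 1 else -1) * (if ε then 1 else 0)

lemma sInt_eq (c : V → Option (Bool × Bool)) (w : V) : sInt c w = sval (c w) := by
  unfold sInt sval; rfl

variable {R : Type*} [CommRing R]

/-- The summand attached to a thickened arc. -/
def term (x : V × V → R) (c : V → Option (Bool × Bool)) (t : TArc V) : R :=
  ((sval (c (other G t)) : ℤ) : R) * x t.1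

lemma zsum (x : V × V → R) (c : V → Option (Bool × Bool)) (bar δ ε : Bool) (v : V)
    (h : c v = some (δ, ε)) :
    ∑ e ∈ G.arcs, G.zfun x c bar v e = ∑ t ∈ side G (δ == bar) v, term G x c t := by
  unfold side
  rw [Finset.sum_filter, Fintype.sum_prod_type, ← Finset.sum_filter_add_sum_filter_not univ
    (fun e => e ∈ G.arcs)]
  rw [Finset.sum_eq_zero (s := univ.filter fun e => e ∉ G.arcs), add_zero]
  · rw [Finset.filter_mem_eq_inter, Finset.univ_inter]
    refine Finset.sum_congr rfl fun e he => ?_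
    obtain ⟨a, w⟩ := e
    have hr : (a, w) ∈ G.red → a ≠ w := by
      rintro h rfl; exact G.red_no_loop _ h
    simp only [zfun, h, Fintype.sum_bool, Valid, tvert, src, term, other, he, sInt_eq]
    by_cases h1 : (a, w) ∈ G.red
    · have := hr h1
      by_cases h2 : a = v
      · subst h2
        cases δ <;> cases bar <;> simp [h1, this, this.symm]
      · simp [h1, h2]
    · by_cases h2 : a = v
      · subst h2
        by_cases h3 : w = a
        · subst h3
          cases δ <;> cases bar <;> simp [h1]
        · cases δ <;> cases bar <;> simp [h1, h3, Ne.symm h3]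
      · by_cases h3 : w = v
        · subst h3
          cases δ <;> cases bar <;> simp [h1, h2]
        · simp [h1, h2, h3]
  · intro e he
    have he : e ∉ G.arcs := by simpa using he
    simp [Valid, he]

lemma small_sum {α : Type*} [DecidableEq α] (S : Finset α) (a b : R) (f : α → R) :
    a + b * ∑ t ∈ S, f t =
      ∑ B ∈ S.powerset.filter (fun B => B.card ≤ 1),
        (if B.card = 0 then a else b) * ∏ t ∈ B, f t := by
  have : S.powerset.filter (fun B => B.card ≤ 1)
      = insert ∅ (S.map ⟨singleton, Finset.singleton_injective⟩) := by
    ext B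
    simp only [mem_filter, mem_powerset, mem_insert, mem_map, Function.Embedding.coeFn_mk]
    constructor
    · rintro ⟨h1, h2⟩
      rcases Nat.lt_or_ge 0 B.card with h | h
      · obtain ⟨t, rfl⟩ := Finset.card_eq_one.1 (le_antisymm h2 h)
        exact Or.inr ⟨t, by simpa using h1, rfl⟩
      · exact Or.inl (by simpa using h)
    · rintro (rfl | ⟨t, ht, rfl⟩) <;> simp [*]
  rw [this, Finset.sum_insert, Finset.sum_map, Finset.mul_sum]
  · simp
  · simp

/-- Coefficient of a color in the expansion: `i`, `o` count chosen entering/leaving arcs. -/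
def cf (lam : R) (col : Option (Bool × Bool)) (i o : ℕ) : R :=
  match col with
  | none => (if i = 0 then 1 else 0) * (if o = 0 then lam + 2 else 0)
  | some (δ, ε) => - (-1 : R) ^ (if ε then 1 else 0) *
      (if δ then (if i = 0 then 1 else 1) * (if o = 0 then lam + 1 else -1)
        else (if i = 0 then lam + 1 else -1) * (if o = 0 then 1 else 1))

/-- Small subsets of a side. -/
def Q (b : Bool) (v : V) : Finset (Finset (TArc V)) :=
  (side G b v).powerset.filter (fun B => B.card ≤ 1)

/-- The weight of a vertex. -/
noncomputable def W (lam : R) (x : V × V → R) (c : V → Option (Bool × Bool)) (v : V) : R :=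
  if c v = none then lam + 2 else G.omegaC lam x c v

lemma W_eq (lam : R) (x : V × V → R) (c : V → Option (Bool × Bool)) (v : V) :
    W G lam x c v = ∑ p ∈ Q G false v ×ˢ Q G true v,
      cf lam (c v) p.1.card p.2.card * ((∏ t ∈ p.1, term G x c t) * ∏ t ∈ p.2, term G x c t) := by
  have key : ∀ (k a b a' b' : R),
      k * (a + b * ∑ t ∈ side G false v, term G x c t) *
        (a' + b' * ∑ t ∈ side G true v, term G x c t) =
      ∑ p ∈ Q G false v ×ˢ Q G true v,
        (k * ((if p.1.card = 0 then a else b) * (if p.2.card = 0 then a' else b'))) *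
          ((∏ t ∈ p.1, term G x c t) * ∏ t ∈ p.2, term G x c t) := by
    intro k a b a' b'
    rw [small_sum, small_sum, mul_assoc, Finset.sum_mul_sum, ← Finset.sum_product', Finset.mul_sum]
    refine Finset.sum_congr rfl fun p _ => ?_
    ring
  unfold W
  rcases h : c v with _ | ⟨δ, ε⟩
  · have := key 1 1 0 (lam + 2) 0
    simp only [cf]
    simp only [one_mul, zero_mul, add_zero] at this
    simpa using this
  · simp only [omegaC, h, cf, reduceCtorEq, if_false]
    rw [zsum G x c false δ ε v h, zsum G x c true δ ε v h]
    cases δ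
    · have := key (- (-1 : R) ^ (if ε then 1 else 0)) (lam + 1) (-1) 1 1
      simp only [Bool.false_eq_true, if_false]
      rw [← this]
      simp only [BEq.rfl, Bool.false_beq, Bool.not_true]
      ring
    · have := key (- (-1 : R) ^ (if ε then 1 else 0)) 1 1 (lam + 1) (-1)
      simp only [if_true]
      rw [← this]
      simp only [BEq.rfl, Bool.true_beq]
      ring

lemma J'_eq_W (lam : R) (x : V × V → R) :
    G.J' lam x = ∑ c : V → Option (Bool × Bool), ∏ v, W G lam x c v := by
  unfold J' W
  refine Finset.sum_congr rfl fun c _ => ?_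
  rw [Finset.prod_ite, Finset.prod_const]
  congr 2
  ext v
  simp [Option.isSome_iff_ne_none]

/-- Arcs of `K` on one side. -/
def part (K : Finset (TArc V)) (b : Bool) (v : V) : Finset (TArc V) :=
  K.filter fun t => G.tvert t = v ∧ (G.src t = v ↔ b = true)

/-- Collections arising in the expansion. -/
def Good (K : Finset (TArc V)) : Prop :=
  (∀ t ∈ K, Valid G t) ∧ ∀ b v, (part G K b v).card ≤ 1

/-- The number of non-thickened ends at `v`. -/
def mm (K : Finset (TArc V)) (v : V) : ℕ := (K.filter fun t => other G t = v).card

lemma part_union (K : Finset (TArc V)) (v : V) :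
    part G K false v ∪ part G K true v = K.filter fun t => G.tvert t = v := by
  ext t; simp only [part, mem_union, mem_filter]
  by_cases h : G.src t = v <;> simp [h]

lemma part_disj (K : Finset (TArc V)) (v : V) :
    Disjoint (part G K false v) (part G K true v) := by
  rw [Finset.disjoint_left]
  intro t; simp only [part, mem_filter]; simp; tauto

lemma part_card (K : Finset (TArc V)) (v : V) :
    (part G K false v).card + (part G K true v).card = G.thickAt K v := by
  rw [← Finset.card_union_of_disjoint (part_disj G K v), part_union]; rfl

lemma part_out (K : Finset (TArc V)) (v : V) :
    (part G K true v).card = G.outThickAt K v := by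
  simp [part, outThickAt]

open Classical in
lemma expand (lam : R) (x : V × V → R) (c : V → Option (Bool × Bool)) :
    ∏ v, W G lam x c v = ∑ K : Finset (TArc V) with Good G K,
      (∏ v, cf lam (c v) (part G K false v).card (part G K true v).card) *
        ∏ t ∈ K, term G x c t := by
  simp_rw [W_eq]
  rw [Finset.prod_univ_sum]
  symm
  refine Finset.sum_bij' (fun K _ v => (part G K false v, part G K true v))
    (fun p _ => univ.biUnion fun v => (p v).1 ∪ (p v).2) ?_ ?_ ?_ ?_ ?_
  · intro K hK
    simp only [mem_filter, mem_univ, true_and] at hK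
    simp only [Fintype.mem_piFinset, mem_product, Q, mem_filter, mem_powerset]
    refine fun v => ⟨⟨?_, hK.2 _ _⟩, ⟨?_, hK.2 _ _⟩⟩ <;>
    · intro t ht
      simp only [part, side, mem_filter, mem_univ, true_and] at ht ⊢
      exact ⟨hK.1 t ht.1, ht.2⟩
  · intro p hp
    simp only [Fintype.mem_piFinset, mem_product, Q, mem_filter, mem_powerset] at hp
    simp only [mem_filter, mem_univ, true_and]
    have h1 : ∀ v, ∀ t ∈ (p v).1, Valid G t ∧ G.tvert t = v ∧ (G.src t = v ↔ false = true) :=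
      fun v t ht => by simpa [side] using (hp v).1.1 ht
    have h2 : ∀ v, ∀ t ∈ (p v).2, Valid G t ∧ G.tvert t = v ∧ (G.src t = v ↔ true = true) :=
      fun v t ht => by simpa [side] using (hp v).2.1 ht
    refine ⟨?_, ?_⟩
    · intro t ht
      simp only [mem_biUnion, mem_univ, true_and, mem_union] at ht
      obtain ⟨v, h | h⟩ := ht
      · exact (h1 v t h).1
      · exact (h2 v t h).1
    · intro b v
      cases b
      · refine le_trans (Finset.card_le_card ?_) (hp v).1.2
        intro t ht
        simp only [part, mem_filter, mem_biUnion, mem_univ, true_and, mem_union] at ht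
        obtain ⟨⟨w, h | h⟩, ht, hs⟩ := ht
        · obtain ⟨_, h3, h4⟩ := h1 w t h
          have : w = v := h3.symm.trans ht
          subst this; exact h
        · obtain ⟨_, h3, h4⟩ := h2 w t h
          have : w = v := h3.symm.trans ht
          subst this; simp at h4 hs; exact absurd h4 hs
      · refine le_trans (Finset.card_le_card ?_) (hp v).2.2
        intro t ht
        simp only [part, mem_filter, mem_biUnion, mem_univ, true_and, mem_union] at ht
        obtain ⟨⟨w, h | h⟩, ht, hs⟩ := ht
        · obtain ⟨_, h3, h4⟩ := h1 w t h
          have : w = v := h3.symm.trans ht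
          subst this; simp at h4 hs; exact absurd hs h4
        · obtain ⟨_, h3, h4⟩ := h2 w t h
          have : w = v := h3.symm.trans ht
          subst this; exact h
  · intro K hK
    simp only [part_union]
    ext t; simp
  · intro p hp
    simp only [Fintype.mem_piFinset, mem_product, Q, mem_filter, mem_powerset] at hp
    have h1 : ∀ v, ∀ t ∈ (p v).1, Valid G t ∧ G.tvert t = v ∧ (G.src t = v ↔ false = true) :=
      fun v t ht => by simpa [side] using (hp v).1.1 ht
    have h2 : ∀ v, ∀ t ∈ (p v).2, Valid G t ∧ G.tvert t = v ∧ (G.src t = v ↔ true = true) :=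
      fun v t ht => by simpa [side] using (hp v).2.1 ht
    funext v
    refine Prod.ext ?_ ?_
    · ext t
      simp only [part, mem_filter, mem_biUnion, mem_univ, true_and, mem_union]
      constructor
      · rintro ⟨⟨w, h | h⟩, ht, hs⟩
        · obtain ⟨_, h3, h4⟩ := h1 w t h
          have : w = v := h3.symm.trans ht
          subst this; exact h
        · obtain ⟨_, h3, h4⟩ := h2 w t h
          have : w = v := h3.symm.trans ht
          subst this; simp at h4 hs; exact absurd h4 hs
      · intro h
        exact ⟨⟨v, Or.inl h⟩, (h1 v t h).2⟩
    · ext t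
      simp only [part, mem_filter, mem_biUnion, mem_univ, true_and, mem_union]
      constructor
      · rintro ⟨⟨w, h | h⟩, ht, hs⟩
        · obtain ⟨_, h3, h4⟩ := h1 w t h
          have : w = v := h3.symm.trans ht
          subst this; simp at h4 hs; exact absurd hs h4
        · obtain ⟨_, h3, h4⟩ := h2 w t h
          have : w = v := h3.symm.trans ht
          subst this; exact h
      · intro h
        exact ⟨⟨v, Or.inr h⟩, by simpa using (h2 v t h).2⟩
  · intro K hK
    rw [Finset.prod_mul_distrib]
    congr 1
    simp_rw [← Finset.prod_union (part_disj G K _), part_union]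
    exact (Finset.prod_fiberwise K G.tvert _).symm

/-- The summed local weight. -/
def F (lam : R) (i o m : ℕ) : R :=
  ∑ col : Option (Bool × Bool), cf lam col i o * ((sval col : ℤ) : R) ^ m

lemma F_zero (lam : R) (i o : ℕ) :
    F lam i o 0 = if i = 0 ∧ o = 0 then lam + 2 else 0 := by
  by_cases hi : i = 0 <;> by_cases ho : o = 0 <;>
    simp [F, cf, sval, Fintype.sum_option, Fintype.sum_prod_type, hi, ho]

lemma F_one_one_one (lam : R) : F lam 1 1 1 = 0 := by
  simp [F, cf, sval, Fintype.sum_option, Fintype.sum_prod_type]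

lemma F_two (lam : R) : F lam 1 1 2 = -2 := by
  simp [F, cf, sval, Fintype.sum_option, Fintype.sum_prod_type]

lemma F_in (lam : R) : F lam 1 0 1 = lam + 2 := by
  simp [F, cf, sval, Fintype.sum_option, Fintype.sum_prod_type]; ring

lemma F_out (lam : R) : F lam 0 1 1 = -(lam + 2) := by
  simp [F, cf, sval, Fintype.sum_option, Fintype.sum_prod_type]; ring

lemma F_low (lam : R) (i o m : ℕ) (hi : i ≤ 1) (ho : o ≤ 1) (h : m < i + o) :
    F lam i o m = 0 := by
  rcases Nat.eq_zero_or_pos m with rfl | hm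
  · rw [F_zero, if_neg]; omega
  · obtain rfl : i = 1 := by omega
    obtain rfl : o = 1 := by omega
    obtain rfl : m = 1 := by omega
    exact F_one_one_one lam

lemma F_eq (lam : R) (i o : ℕ) (hi : i ≤ 1) (ho : o ≤ 1) :
    F lam i o (i + o) = (if i + o = 2 then 2 else lam + 2) * (-1) ^ o := by
  interval_cases i <;> interval_cases o
  · simp [F_zero]
  · simp [F_out]
  · simp [F_in]
  · simp [F_two]

lemma prod_term (x : V × V → R) (c : V → Option (Bool × Bool)) (K : Finset (TArc V)) :
    ∏ t ∈ K, term G x c t =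
      (∏ v, ((sval (c v) : ℤ) : R) ^ mm G K v) * ∏ t ∈ K, x t.1 := by
  unfold term mm
  rw [Finset.prod_mul_distrib]
  congr 1
  rw [← Finset.prod_fiberwise K (other G)]
  refine Finset.prod_congr rfl fun v _ => ?_
  rw [Finset.prod_congr rfl (g := fun _ => ((sval (c v) : ℤ) : R)), Finset.prod_const]
  intro t ht
  rw [(mem_filter.1 ht).2]

open Classical in
lemma J'_eq_sum (lam : R) (x : V × V → R) :
    G.J' lam x = ∑ K : Finset (TArc V) with Good G K,
      (∏ v, F lam (part G K false v).card (part G K true v).card (mm G K v)) *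
        ∏ t ∈ K, x t.1 := by
  rw [J'_eq_W]
  simp_rw [expand]
  rw [Finset.sum_comm]
  refine Finset.sum_congr rfl fun K _ => ?_
  simp_rw [prod_term, ← mul_assoc, ← Finset.prod_mul_distrib]
  rw [← Finset.sum_mul]
  congr 1
  unfold F
  rw [Finset.prod_univ_sum, Fintype.piFinset_univ]

lemma degAt_eq (K : Finset (TArc V)) (v : V) : degAt K v = G.thickAt K v + mm G K v := by
  unfold degAt thickAt mm
  rw [Finset.card_filter, Finset.card_filter, ← Finset.sum_add_distrib]
  refine Finset.sum_congr rfl fun t _ => ?_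
  unfold tvert other
  split_ifs <;> simp_all

lemma sum_thick (K : Finset (TArc V)) : ∑ v, G.thickAt K v = K.card :=
  (Finset.card_eq_sum_card_fiberwise (fun _ _ => mem_univ _)).symm

lemma sum_mm (K : Finset (TArc V)) : ∑ v, mm G K v = K.card :=
  (Finset.card_eq_sum_card_fiberwise (fun _ _ => mem_univ _)).symm

lemma acceptable_iff (K : Finset (TArc V)) :
    G.IsAcceptable K ↔ Good G K ∧ ∀ v, mm G K v = G.thickAt K v := by
  constructor
  · intro h
    have h1 : ∀ v, mm G K v = G.thickAt K v := fun v => by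
      have := h.half_thick v
      rw [degAt_eq G] at this; omega
    refine ⟨⟨fun t ht => ⟨h.mem_arcs t ht, h.loop_thick t ht⟩, fun b v => ?_⟩, h1⟩
    have a1 := h.half_thick v
    have a2 := h.deg024 v
    have a3 := h.balance v
    rw [← part_out] at a3
    have a4 := part_card G K v
    cases b <;> omega
  · rintro ⟨h1, h2⟩
    refine ⟨fun t ht => (h1.1 t ht).1, fun t ht => (h1.1 t ht).2, fun v => ?_, fun v => ?_,
      fun v => ?_⟩ <;>
    · have a1 := h1.2 true v
      have a2 := h1.2 false v
      have a3 := part_card G K v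
      have a4 := h2 v
      have a5 := degAt_eq G K v
      have a6 := part_out G K v
      omega

lemma aK_eq (K : Finset (TArc V)) : G.aK K = ∑ v, (part G K true v).card := by
  unfold aK
  rw [Finset.card_eq_sum_card_fiberwise (f := G.tvert) (t := univ) (fun _ _ => mem_univ _)]
  refine Finset.sum_congr rfl fun v _ => ?_
  congr 1
  ext t
  simp only [part, mem_filter]
  constructor
  · rintro ⟨⟨a, b⟩, c⟩; exact ⟨a, c, by simp [b, c]⟩
  · rintro ⟨a, b, c⟩; exact ⟨⟨a, by simp at c; rw [c, b]⟩, b⟩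

theorem main (lam : R) (x : V × V → R) : G.J' lam x = G.J lam x := by
  classical
  rw [J'_eq_sum, Finset.sum_filter]
  unfold J
  refine Finset.sum_congr rfl fun K _ => ?_
  by_cases hK : Good G K
  · rw [if_pos hK]
    by_cases hm : ∀ v, mm G K v = G.thickAt K v
    · rw [if_pos ((acceptable_iff G K).2 ⟨hK, hm⟩)]
      have : ∀ v, F lam (part G K false v).card (part G K true v).card (mm G K v) =
          (if degAt K v = 4 then 2 else lam + 2) * (-1) ^ (part G K true v).card := fun v => by
        rw [hm, ← part_card, F_eq lam _ _ (hK.2 _ _) (hK.2 _ _)]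
        congr 1
        refine if_congr ?_ rfl rfl
        have a4 := hm v
        have a5 := degAt_eq G K v
        have a3 := part_card G K v
        omega
      simp_rw [this]
      rw [Finset.prod_mul_distrib, Finset.prod_ite, Finset.prod_const, Finset.prod_const,
        Finset.prod_pow_eq_pow_sum, ← aK_eq]
      have hc : (univ.filter fun v => ¬ degAt K v = 4).card = Fintype.card V - deg4 K := by
        have := Finset.card_filter_add_card_filter_not (s := univ) (fun v : V => degAt K v = 4)
        rw [Finset.card_univ] at this
        unfold deg4; omega
      rw [hc]
      unfold deg4
      ring
    · rw [if_neg (fun h => hm ((acceptable_iff G K).1 h).2)]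
      have : ∃ v, mm G K v < G.thickAt K v := by
        by_contra! hcon
        apply hm
        have := (Finset.sum_eq_sum_iff_of_le (s := univ) (fun v _ => hcon v)).1
          ((sum_thick G K).trans (sum_mm G K).symm)
        exact fun v => (this v (mem_univ v)).symm
      obtain ⟨v, hv⟩ := this
      rw [Finset.prod_eq_zero (mem_univ v), zero_mul]
      exact F_low lam _ _ _ (hK.2 _ _) (hK.2 _ _) (by rw [part_card]; exact hv)
  · rw [if_neg hK, if_neg (fun h => hK ((acceptable_iff G K).1 h).1)]

end JProof


/-- **Theorem 3.** For every looped digraph `G`, the two partition functions agree: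
`J′(G) = J(G)` as polynomials in `λ` and the variables `x_e`. -/
theorem J'_eq_J {V : Type*} [Fintype V] [DecidableEq V] (G : LoopedDigraph V) :
    G.J' (R := MvPolynomial (V × V) (Polynomial ℚ)) (MvPolynomial.C Polynomial.X)
        (fun e => MvPolynomial.X e)
    = G.J (MvPolynomial.C Polynomial.X) (fun e => MvPolynomial.X e) := by
  exact JProof.main G _ _
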